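/- Let u ∈ ℝ^d satisfy u ≥ 0 componentwise, and suppose the maximal solution U^u of system (1.1) is global with U^u(t) → 𝟙 as t → ∞. Then: (a) for every v ∈ ℝ^d with 0 ≤ v ≤ u componentwise and v ≠ u, the maximal solution U^v is global and U^v(t) → 0 as t → ∞; (b) for every v ∈ ℝ^d with v ≥ u componentwise and v ≠ u, the maximal solution U^v blows up in finite time. -/

import Mathlib

open scoped BigOperators
open Filter Topology Set

/-- The `n`-th coordinate (0-based) of a vector in `ℝ^d`, with junk value `0` out of range. -/
noncomputable def coordFn {d : ℕ} (u : Fin d → ℝ) (n : ℕ) : ℝ :=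
  if hn : n < d then u ⟨n, hn⟩ else 0

/-- The vector field `b` of system (1.1) (0-based indices: coordinate `1 ≤ k ≤ d` of the paper
is coordinate `k - 1` here). -/
noncomputable def bField (d : ℕ) (h p : ℝ) (u : Fin d → ℝ) (i : Fin d) : ℝ :=
  if (i : ℕ) = 0 then (2 / h ^ 2) * (-coordFn u 0 + coordFn u 1)
  else if (i : ℕ) = d - 1 then
    (2 / h ^ 2) * (-coordFn u (d - 1) + coordFn u (d - 2)
      + h * ((max (coordFn u (d - 1)) 0) ^ p - coordFn u (d - 1)))
  else (1 / h ^ 2) * (coordFn u ((i : ℕ) + 1) - 2 * coordFn u (i : ℕ) + coordFn u ((i : ℕ) - 1))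

/-- The Euclidean norm on `ℝ^d`. -/
noncomputable def euclNorm {d : ℕ} (u : Fin d → ℝ) : ℝ := Real.sqrt (∑ i, (u i) ^ 2)

/-- `u` belongs to the domain of explosion `D_e`: the (unique, maximal) solution of (1.1)
starting at `u` blows up in finite time, i.e. there are `τ < ∞` and a solution `U` of (1.1)
on `[0, τ)` with `U(0) = u` and `|U(t)| → ∞` as `t → τ⁻`. -/
def BlowsUp (d : ℕ) (h p : ℝ) (u : Fin d → ℝ) : Prop :=
  ∃ (τ : ℝ) (U : ℝ → Fin d → ℝ), 0 < τ ∧ U 0 = u ∧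
    (∀ t ∈ Set.Ico 0 τ, HasDerivWithinAt U (bField d h p (U t)) (Set.Ico 0 τ) t) ∧
    Filter.Tendsto (fun t => euclNorm (U t)) (nhdsWithin τ (Set.Iio τ)) Filter.atTop

/-- The (unique, maximal) solution of (1.1) starting at `u` is global and converges to `L`
as `t → ∞`. -/
def GlobalTo (d : ℕ) (h p : ℝ) (u L : Fin d → ℝ) : Prop :=
  ∃ U : ℝ → Fin d → ℝ, U 0 = u ∧
    (∀ t : ℝ, 0 ≤ t → HasDerivWithinAt U (bField d h p (U t)) (Set.Ici 0) t) ∧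
    Filter.Tendsto U Filter.atTop (nhds L)

lemma LocallyLipschitz.exists_lipschitzOnWith_closedBall {E : Type*} [NormedAddCommGroup E]
    [ProperSpace E] {F : E → E} (hF : LocallyLipschitz F) (R : ℝ) :
    ∃ K, LipschitzOnWith K F (Metric.closedBall 0 R) :=
  LocallyLipschitzOn.exists_lipschitzOnWith_of_compact (isCompact_closedBall 0 R)
    hF.locallyLipschitzOn

section LocallyLipschitzFlow

variable {E : Type*} [NormedAddCommGroup E] [NormedSpace ℝ E]

/-- Two integral curves on consecutive intervals which agree at the common endpoint can be
concatenated. -/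
lemma IsIntegralCurveOn.piecewise_Icc {F : ℝ → E → E} {f g : ℝ → E} {a b c : ℝ}
    (hab : a ≤ b) (hbc : b ≤ c) (hf : IsIntegralCurveOn f F (Icc a b))
    (hg : IsIntegralCurveOn g F (Icc b c)) (hfg : f b = g b) :
    IsIntegralCurveOn (fun t => if t ≤ b then f t else g t) F (Icc a c) := by
  have hl : EqOn (fun t => if t ≤ b then f t else g t) f (Icc a b) := fun t ht => if_pos ht.2
  have hr : EqOn (fun t => if t ≤ b then f t else g t) g (Icc b c) := by
    intro t ht
    rcases ht.1.eq_or_lt with rfl | h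
    · simp [hfg]
    · simp [h.not_ge]
  intro t ht
  rcases lt_trichotomy t b with h | rfl | h
  · have htb : t ∈ Icc a b := ⟨ht.1, h.le⟩
    have h1 := (hf t htb).congr hl (hl htb)
    rw [← hl htb] at h1
    refine h1.mono_of_mem_nhdsWithin ?_
    filter_upwards [self_mem_nhdsWithin, mem_nhdsWithin_of_mem_nhds (Iio_mem_nhds h)] with s hs hs'
    exact ⟨hs.1, le_of_lt hs'⟩
  · have h1 := (hf t ⟨hab, le_rfl⟩).congr hl (hl ⟨hab, le_rfl⟩)
    have h2 := (hg t ⟨le_rfl, hbc⟩).congr hr (hr ⟨le_rfl, hbc⟩)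
    rw [← hl ⟨hab, le_rfl⟩] at h1
    rw [← hr ⟨le_rfl, hbc⟩] at h2
    rw [← Icc_union_Icc_eq_Icc hab hbc]
    exact h1.union h2
  · have htb : t ∈ Icc b c := ⟨h.le, ht.2⟩
    have h1 := (hg t htb).congr hr (hr htb)
    rw [← hr htb] at h1
    refine h1.mono_of_mem_nhdsWithin ?_
    filter_upwards [self_mem_nhdsWithin, mem_nhdsWithin_of_mem_nhds (Ioi_mem_nhds h)] with s hs hs'
    exact ⟨le_of_lt hs', hs.2⟩

variable [ProperSpace E] {F : E → E}

lemma IsIntegralCurveOn.eqOn_Icc (hF : LocallyLipschitz F) {f g : ℝ → E} {a b : ℝ}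
    (hf : IsIntegralCurveOn f (fun _ => F) (Icc a b))
    (hg : IsIntegralCurveOn g (fun _ => F) (Icc a b)) (h0 : f a = g a) :
    EqOn f g (Icc a b) := by
  obtain ⟨R, hR⟩ := isCompact_Icc.exists_bound_of_continuousOn hf.continuousOn
  obtain ⟨R', hR'⟩ := isCompact_Icc.exists_bound_of_continuousOn hg.continuousOn
  obtain ⟨K, hK⟩ := hF.exists_lipschitzOnWith_closedBall (max R R')
  refine ODE_solution_unique_of_mem_Icc_right (v := fun _ => F)
    (s := fun _ => Metric.closedBall 0 (max R R')) (fun _ _ => hK) hf.continuousOn ?_ ?_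
    hg.continuousOn ?_ ?_ h0
  · exact fun t ht => (hf t ⟨ht.1, ht.2.le⟩).mono_of_mem_nhdsWithin
      (Icc_mem_nhdsGE_of_mem ht)
  · intro t ht
    simpa using Or.inl (hR t ⟨ht.1, ht.2.le⟩)
  · exact fun t ht => (hg t ⟨ht.1, ht.2.le⟩).mono_of_mem_nhdsWithin
      (Icc_mem_nhdsGE_of_mem ht)
  · intro t ht
    simpa using Or.inr (hR' t ⟨ht.1, ht.2.le⟩)

/-- The existence time of an autonomous ODE is bounded below uniformly over bounded sets of
initial values. -/
lemma LocallyLipschitz.exists_uniform_time (hF : LocallyLipschitz F) (N : ℝ) :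
    ∃ ε > 0, ∀ (t₀ : ℝ) (x : E), ‖x‖ ≤ N →
      ∃ g : ℝ → E, g t₀ = x ∧ IsIntegralCurveOn g (fun _ => F) (Icc t₀ (t₀ + ε)) := by
  obtain ⟨K, hK⟩ := hF.exists_lipschitzOnWith_closedBall (|N| + 1)
  obtain ⟨L, hL⟩ := (isCompact_closedBall (0 : E) (|N| + 1)).exists_bound_of_continuousOn
    hF.continuous.continuousOn
  have hL0 : 0 < |L| + 1 := by positivity
  refine ⟨1 / (|L| + 1), by positivity, fun t₀ x hx => ?_⟩
  have hε : 0 < 1 / (|L| + 1) := by positivity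
  have hsub : Metric.closedBall x ((1 : NNReal) : ℝ) ⊆ Metric.closedBall 0 (|N| + 1) := by
    refine Metric.closedBall_subset_closedBall' ?_
    rw [dist_zero_right]
    push_cast
    linarith [le_abs_self N]
  have hPL : IsPicardLindelof (fun _ => F) (tmin := t₀) (tmax := t₀ + 1 / (|L| + 1))
      ⟨t₀, le_rfl, by linarith⟩ x 1 0 (Real.toNNReal (|L| + 1)) K := by
    refine ⟨fun _ _ => hK.mono hsub, fun _ _ => continuousOn_const, fun _ _ y hy => ?_, ?_⟩
    · rw [Real.coe_toNNReal _ hL0.le]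
      linarith [hL y (hsub hy), le_abs_self L]
    · rw [Real.coe_toNNReal _ hL0.le]
      have : max (t₀ + 1 / (|L| + 1) - t₀) (t₀ - t₀) = 1 / (|L| + 1) := by
        rw [add_sub_cancel_left, sub_self, max_eq_left hε.le]
      rw [this]
      push_cast
      rw [mul_one_div_cancel hL0.ne', sub_zero]
  obtain ⟨g, hg0, hg⟩ := hPL.exists_eq_forall_mem_Icc_hasDerivWithinAt₀
  exact ⟨g, hg0, hg⟩

/-- Solutions on an increasing family of intervals assemble to a solution on their union. -/
lemma exists_isIntegralCurveOn_of_forall_exists (hF : LocallyLipschitz F) {u : E} {J : Set ℝ}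
    (hJ : J ⊆ Ici 0) (h0 : 0 ∈ J)
    (h : ∀ t ∈ J, ∃ T > t, ∃ f : ℝ → E, f 0 = u ∧ IsIntegralCurveOn f (fun _ => F) (Icc 0 T)) :
    ∃ U : ℝ → E, U 0 = u ∧ IsIntegralCurveOn U (fun _ => F) J := by
  choose! T hT f hf0 hf using h
  refine ⟨fun t => f t t, hf0 0 h0, fun t ht => ?_⟩
  have key : ∀ s ∈ J ∩ Icc 0 (T t), f s s = f t s := by
    intro s hs
    have hs0 : 0 ≤ s := hs.2.1
    refine IsIntegralCurveOn.eqOn_Icc hF ((hf s hs.1).mono (Icc_subset_Icc_right (hT s hs.1).le))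
      ((hf t ht).mono (Icc_subset_Icc_right hs.2.2)) ?_ ⟨hs0, le_rfl⟩
    rw [hf0 s hs.1, hf0 t ht]
  have hmem : Icc 0 (T t) ∈ 𝓝[J] t := by
    filter_upwards [self_mem_nhdsWithin, mem_nhdsWithin_of_mem_nhds (Iio_mem_nhds (hT t ht))]
      with s hs hs'
    exact ⟨hJ hs, le_of_lt hs'⟩
  refine ((hf t ht t ⟨hJ ht, (hT t ht).le⟩).mono_of_mem_nhdsWithin hmem).congr_of_eventuallyEq
    ?_ rfl
  filter_upwards [self_mem_nhdsWithin, hmem] with s hs hs'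
  exact key s ⟨hs, hs'⟩

/-- The maximal solution of an autonomous ODE with locally Lipschitz vector field is either global
or its norm tends to infinity at a finite time. -/
theorem LocallyLipschitz.exists_global_or_blowup (hF : LocallyLipschitz F) (u : E) :
    (∃ U : ℝ → E, U 0 = u ∧ IsIntegralCurveOn U (fun _ => F) (Ici 0)) ∨
    ∃ (τ : ℝ) (U : ℝ → E), 0 < τ ∧ U 0 = u ∧ IsIntegralCurveOn U (fun _ => F) (Ico 0 τ) ∧
      Tendsto (fun t => ‖U t‖) (𝓝[<] τ) atTop := by
  set S : Set ℝ :=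
    {T | ∃ f : ℝ → E, f 0 = u ∧ IsIntegralCurveOn f (fun _ => F) (Icc 0 T)} with hS
  by_cases hb : BddAbove S
  · right
    obtain ⟨ε₀, hε₀, h₀⟩ := hF.exists_uniform_time ‖u‖
    obtain ⟨g₀, hg₀, hg₀'⟩ := h₀ 0 u le_rfl
    have hε₀S : ε₀ ∈ S := ⟨g₀, hg₀, by simpa using hg₀'⟩
    have hτ : 0 < sSup S := hε₀.trans_le (le_csSup hb hε₀S)
    obtain ⟨U, hU0, hU⟩ := exists_isIntegralCurveOn_of_forall_exists hF (u := u)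
      (J := Ico 0 (sSup S)) (fun t ht => ht.1) ⟨le_rfl, hτ⟩ (fun t ht => by
        obtain ⟨T, hT, htT⟩ := exists_lt_of_lt_csSup ⟨_, hε₀S⟩ ht.2
        exact ⟨T, htT, hT⟩)
    refine ⟨sSup S, U, hτ, hU0, hU, ?_⟩
    by_contra hcon
    rw [tendsto_atTop] at hcon
    push Not at hcon
    obtain ⟨N, hN⟩ := hcon
    obtain ⟨ε, hε, hloc⟩ := hF.exists_uniform_time N
    have hev : ∀ᶠ t in 𝓝[<] (sSup S), t ∈ Ioo (max 0 (sSup S - ε)) (sSup S) :=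
      Ioo_mem_nhdsLT (max_lt hτ (by linarith))
    obtain ⟨t, htN, ht1, ht2⟩ := (hN.and_eventually hev).exists
    have ht0 : 0 ≤ t := (le_max_left _ _).trans ht1.le
    obtain ⟨g, hg0, hg⟩ := hloc t (U t) htN.le
    have hmem : t + ε ∈ S := by
      refine ⟨_, ?_, IsIntegralCurveOn.piecewise_Icc ht0 (by linarith)
        (hU.mono fun s hs => ⟨hs.1, hs.2.trans_lt ht2⟩) hg hg0.symm⟩
      simp [ht0, hU0]
    linarith [le_csSup hb hmem, (le_max_right _ _).trans_lt ht1]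
  · left
    refine exists_isIntegralCurveOn_of_forall_exists hF subset_rfl self_mem_Ici fun t _ => ?_
    rw [not_bddAbove_iff] at hb
    obtain ⟨T, hT, htT⟩ := hb t
    exact ⟨T, htT, hT⟩

end LocallyLipschitzFlow

section DifferentialInequalities

lemma hasDerivAt_min_zero_sq (x : ℝ) :
    HasDerivAt (fun y : ℝ => (min y 0) ^ 2) (2 * min x 0) x := by
  rcases lt_trichotomy x 0 with hx | rfl | hx
  · have h1 : HasDerivAt (fun y : ℝ => y ^ 2) (2 * x) x := by simpa using hasDerivAt_pow 2 x
    rw [min_eq_left hx.le]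
    refine h1.congr_of_eventuallyEq ?_
    filter_upwards [Iio_mem_nhds hx] with y hy
    rw [min_eq_left (le_of_lt hy)]
  · rw [hasDerivAt_iff_isLittleO]
    have h2 : (fun y : ℝ => y ^ 2) =o[𝓝 0] fun y : ℝ => y := by
      simpa using Asymptotics.isLittleO_pow_pow (𝕜 := ℝ) (m := 1) (n := 2) (by norm_num)
    simp only [min_self, ne_eq, OfNat.ofNat_ne_zero, not_false_eq_true, zero_pow, sub_zero,
      mul_zero, smul_zero]
    refine Asymptotics.IsBigO.trans_isLittleO (Asymptotics.IsBigO.of_bound 1 ?_) h2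
    refine Eventually.of_forall fun y => ?_
    rw [one_mul, norm_pow, norm_pow]
    refine pow_le_pow_left₀ (norm_nonneg _) ?_ 2
    rw [Real.norm_eq_abs, Real.norm_eq_abs]
    rcases le_total y 0 with hy | hy <;> simp [hy]
  · rw [min_eq_right hx.le, mul_zero]
    refine (hasDerivAt_const x (0 : ℝ)).congr_of_eventuallyEq ?_
    filter_upwards [Ioi_mem_nhds hx] with y hy
    rw [min_eq_right (le_of_lt hy)]
    norm_num

lemma HasDerivWithinAt.mul_exp {f : ℝ → ℝ} {f' K t : ℝ} {s : Set ℝ}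
    (hf : HasDerivWithinAt f f' s t) :
    HasDerivWithinAt (fun t => f t * Real.exp (K * t)) ((f' + K * f t) * Real.exp (K * t)) s t := by
  have h1 : HasDerivAt (fun t : ℝ => Real.exp (K * t)) (Real.exp (K * t) * K) t := by
    simpa using ((hasDerivAt_id t).const_mul K).exp
  exact (hf.mul h1.hasDerivWithinAt).congr_deriv (by ring)

lemma monotoneOn_mul_exp {f f' : ℝ → ℝ} {a b K : ℝ}
    (hf : ∀ t ∈ Icc a b, HasDerivWithinAt f (f' t) (Icc a b) t)
    (hK : ∀ t ∈ Icc a b, -K * f t ≤ f' t) :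
    MonotoneOn (fun t => f t * Real.exp (K * t)) (Icc a b) := by
  refine monotoneOn_of_hasDerivWithinAt_nonneg (convex_Icc a b)
    (f' := fun t => (f' t + K * f t) * Real.exp (K * t))
    (fun t ht => (hf t ht).mul_exp.continuousWithinAt) (fun t ht => ?_) (fun t ht => ?_)
  · exact (hf t (interior_subset ht)).mul_exp.mono interior_subset
  · have := hK t (interior_subset ht)
    exact mul_nonneg (by linarith) (Real.exp_pos _).le

lemma strictMonoOn_mul_exp {f f' : ℝ → ℝ} {a b K : ℝ}
    (hf : ∀ t ∈ Icc a b, HasDerivWithinAt f (f' t) (Icc a b) t)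
    (hK : ∀ t ∈ Ioo a b, -K * f t < f' t) :
    StrictMonoOn (fun t => f t * Real.exp (K * t)) (Icc a b) := by
  refine strictMonoOn_of_hasDerivWithinAt_pos (convex_Icc a b)
    (f' := fun t => (f' t + K * f t) * Real.exp (K * t))
    (fun t ht => (hf t ht).mul_exp.continuousWithinAt) (fun t ht => ?_) (fun t ht => ?_)
  · exact (hf t (interior_subset ht)).mul_exp.mono interior_subset
  · rw [interior_Icc] at ht
    have := hK t ht
    exact mul_pos (by linarith) (Real.exp_pos _)

end DifferentialInequalities

section DiffusionField

/-- The discrete diffusion part of system (1.1), with prescribed boundary flux `y` in the last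
coordinate. -/
noncomputable def diffusionField (d : ℕ) (h y : ℝ) (u : Fin d → ℝ) (i : Fin d) : ℝ :=
  if (i : ℕ) = 0 then (2 / h ^ 2) * (-coordFn u 0 + coordFn u 1)
  else if (i : ℕ) = d - 1 then
    (2 / h ^ 2) * (-coordFn u (d - 1) + coordFn u (d - 2) + h * y)
  else (1 / h ^ 2) * (coordFn u ((i : ℕ) + 1) - 2 * coordFn u (i : ℕ) + coordFn u ((i : ℕ) - 1))

/-- The boundary flux of system (1.1). -/
noncomputable def boundaryFlux (p x : ℝ) : ℝ := (max x 0) ^ p - x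

variable {d : ℕ} {h : ℝ}

lemma bField_eq_diffusionField (p : ℝ) (u : Fin d → ℝ) :
    bField d h p u = diffusionField d h (boundaryFlux p (coordFn u (d - 1))) u := rfl

lemma coordFn_coe (u : Fin d → ℝ) (i : Fin d) : coordFn u i = u i := by
  simp [coordFn]

lemma coordFn_sub (u v : Fin d → ℝ) (n : ℕ) :
    coordFn (u - v) n = coordFn u n - coordFn v n := by
  unfold coordFn; split_ifs <;> simp

lemma coordFn_smul (c : ℝ) (u : Fin d → ℝ) (n : ℕ) :
    coordFn (c • u) n = c * coordFn u n := by
  unfold coordFn; split_ifs <;> simp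

lemma coordFn_nonneg {u : Fin d → ℝ} (hu : 0 ≤ u) (n : ℕ) : 0 ≤ coordFn u n := by
  unfold coordFn; split_ifs
  exacts [hu _, le_rfl]

lemma coordFn_mono {u v : Fin d → ℝ} (huv : u ≤ v) (n : ℕ) : coordFn u n ≤ coordFn v n := by
  unfold coordFn; split_ifs
  exacts [huv _, le_rfl]

lemma abs_coordFn_le (u : Fin d → ℝ) (n : ℕ) : |coordFn u n| ≤ ‖u‖ := by
  unfold coordFn; split_ifs
  exacts [norm_le_pi_norm u _, by simp]

lemma contDiff_coordFn (n : ℕ) : ContDiff ℝ 1 fun u : Fin d → ℝ => coordFn u n := by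
  unfold coordFn; split_ifs <;> fun_prop

lemma diffusionField_sub (y z : ℝ) (u v : Fin d → ℝ) :
    diffusionField d h (y - z) (u - v) = diffusionField d h y u - diffusionField d h z v := by
  ext i
  simp only [diffusionField, coordFn_sub, Pi.sub_apply]
  split_ifs <;> ring

lemma diffusionField_smul (c y : ℝ) (u : Fin d → ℝ) :
    diffusionField d h (c * y) (c • u) = c • diffusionField d h y u := by
  ext i
  simp only [diffusionField, coordFn_smul, Pi.smul_apply, smul_eq_mul]
  split_ifs <;> ring

lemma contDiff_rpow_const_snd {p : ℝ} (hp : 1 ≤ p) :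
    ContDiff ℝ 1 fun q : (Fin d → ℝ) × ℝ => q.2 ^ p := by
  have h1 : ContDiff ℝ 1 fun x : ℝ => x ^ p := by
    simpa using Real.contDiff_rpow_const_of_le (p := p) (n := 1) (by simpa using hp)
  exact h1.comp contDiff_snd

lemma contDiff_diffusionField_rpow {p : ℝ} (hp : 1 ≤ p) :
    ContDiff ℝ 1 fun q : (Fin d → ℝ) × ℝ =>
      diffusionField d h (q.2 ^ p - coordFn q.1 (d - 1)) q.1 := by
  have hc : ∀ n, ContDiff ℝ 1 fun q : (Fin d → ℝ) × ℝ => coordFn q.1 n :=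
    fun n => (contDiff_coordFn n).comp contDiff_fst
  have hr := contDiff_rpow_const_snd (d := d) hp
  rw [contDiff_pi]
  intro i
  unfold diffusionField
  split_ifs
  · exact contDiff_const.mul ((hc _).neg.add (hc _))
  · exact contDiff_const.mul (((hc _).neg.add (hc _)).add (contDiff_const.mul (hr.sub (hc _))))
  · exact contDiff_const.mul (((hc _).sub (contDiff_const.mul (hc _))).add (hc _))

lemma locallyLipschitz_bField {p : ℝ} (hp : 1 ≤ p) : LocallyLipschitz (bField d h p) := by
  have hG := (contDiff_diffusionField_rpow (d := d) (h := h) hp).locallyLipschitz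
  have hc : LocallyLipschitz fun u : Fin d → ℝ => coordFn u (d - 1) :=
    (contDiff_coordFn _).locallyLipschitz
  have hι : LocallyLipschitz fun u : Fin d → ℝ => (u, max (coordFn u (d - 1)) 0) :=
    LocallyLipschitz.id.prodMk (hc.max_const 0)
  have hcomp := hG.comp hι
  refine (congrArg LocallyLipschitz ?_).mp hcomp
  funext u
  rw [bField_eq_diffusionField]
  rfl

lemma sum_min_zero_le (w : Fin d → ℝ) (i : Fin d) : ∑ j, min (w j) 0 ≤ min (w i) 0 := by
  have := Finset.single_le_sum (f := fun j => -min (w j) 0)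
    (fun j _ => neg_nonneg.2 (min_le_right _ _)) (Finset.mem_univ i)
  rw [Finset.sum_neg_distrib] at this
  exact neg_le_neg_iff.1 this

lemma sum_min_zero_le_coordFn (w : Fin d → ℝ) (n : ℕ) : ∑ j, min (w j) 0 ≤ coordFn w n := by
  have hneg : ∀ j, min (w j) 0 ≤ 0 := fun j => min_le_right _ _
  unfold coordFn
  split_ifs with hn
  · exact (sum_min_zero_le w ⟨n, hn⟩).trans (min_le_left _ _)
  · exact Finset.sum_nonpos fun j _ => hneg j

lemma sum_min_zero_le_diffusionField (hh : 0 < h) {L z : ℝ} (hL : 0 ≤ L) {w : Fin d → ℝ}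
    (hz : coordFn w (d - 1) < 0 → L * coordFn w (d - 1) ≤ z) {i : Fin d} (hi : w i < 0) :
    2 / h ^ 2 * (1 + h * L) * ∑ j, min (w j) 0 ≤ diffusionField d h z w i := by
  have hS := sum_min_zero_le_coordFn w
  have hS0 : ∑ j, min (w j) 0 ≤ 0 := Finset.sum_nonpos fun j _ => min_le_right _ _
  set S := ∑ j, min (w j) 0
  have hLS : h * L * S ≤ 0 := mul_nonpos_of_nonneg_of_nonpos (by positivity) hS0
  have hc : 0 ≤ 2 / h ^ 2 := by positivity
  rw [← coordFn_coe w] at hi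
  unfold diffusionField
  split_ifs with h0 h1
  · rw [mul_assoc]
    refine mul_le_mul_of_nonneg_left ?_ hc
    rw [h0] at hi
    linarith [hS 1]
  · rw [mul_assoc]
    refine mul_le_mul_of_nonneg_left ?_ hc
    rw [h1] at hi
    have h2 : h * (L * coordFn w (d - 1)) ≤ h * z := mul_le_mul_of_nonneg_left (hz hi) hh.le
    have h3 : h * L * S ≤ h * L * coordFn w (d - 1) :=
      mul_le_mul_of_nonneg_left (hS _) (by positivity)
    linarith [hS (d - 2)]
  · have : 2 / h ^ 2 * (1 + h * L) * S = 1 / h ^ 2 * (2 * S + 2 * (h * L * S)) := by ring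
    rw [this]
    refine mul_le_mul_of_nonneg_left ?_ (by positivity)
    linarith [hS (i + 1), hS (i - 1)]

/-- Comparison principle: a supersolution of the linear diffusion problem starting from a
nonnegative state stays nonnegative. -/
lemma nonneg_of_diffusionField_le (hh : 0 < h) {L a b : ℝ} (hL : 0 ≤ L)
    {W W' : ℝ → Fin d → ℝ} {z : ℝ → ℝ}
    (hW : ∀ t ∈ Icc a b, HasDerivWithinAt W (W' t) (Icc a b) t)
    (hW' : ∀ t ∈ Icc a b, diffusionField d h (z t) (W t) ≤ W' t)
    (hz : ∀ t ∈ Icc a b, coordFn (W t) (d - 1) < 0 → L * coordFn (W t) (d - 1) ≤ z t)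
    (h0 : 0 ≤ W a) : ∀ t ∈ Icc a b, 0 ≤ W t := by
  set C : ℝ := 2 / h ^ 2 * (1 + h * L)
  have hC : 0 ≤ C := by positivity
  set N : ℝ → ℝ := fun t => ∑ i, (min (W t i) 0) ^ 2
  have hN : ∀ t ∈ Icc a b, HasDerivWithinAt (fun t => -N t)
      (-∑ i, 2 * min (W t i) 0 * W' t i) (Icc a b) t := by
    intro t ht
    refine (HasDerivWithinAt.fun_sum fun i _ => ?_).neg
    exact (hasDerivAt_min_zero_sq (W t i)).comp_hasDerivWithinAt t
      ((hasDerivWithinAt_pi.1 (hW t ht)) i)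
  have hbound : ∀ t ∈ Icc a b,
      -(-(2 * C * d * d)) * (-N t) ≤ -∑ i, 2 * min (W t i) 0 * W' t i := by
    intro t ht
    set S := ∑ j, min (W t j) 0
    have hi : ∀ i, 2 * min (W t i) 0 * W' t i ≤ 2 * C * S ^ 2 := by
      intro i
      rcases le_or_gt 0 (W t i) with hi | hi
      · rw [min_eq_right hi]
        simp only [mul_zero, zero_mul]
        positivity
      · have h1 : C * S ≤ W' t i :=
          (sum_min_zero_le_diffusionField hh hL (hz t ht) hi).trans (hW' t ht i)
        have h2 : S ≤ min (W t i) 0 := sum_min_zero_le (W t) i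
        have h3 : min (W t i) 0 ≤ 0 := min_le_right _ _
        have h4 := mul_le_mul_of_nonpos_left h1 h3
        have h5 : min (W t i) 0 * (C * S) ≤ S * (C * S) :=
          mul_le_mul_of_nonpos_right h2
            (mul_nonpos_of_nonneg_of_nonpos hC (h2.trans h3))
        nlinarith
    have hsum : ∑ i, 2 * min (W t i) 0 * W' t i ≤ d * (2 * C * S ^ 2) := by
      refine (Finset.sum_le_sum fun i _ => hi i).trans ?_
      simp
    have hcs : S ^ 2 ≤ d * N t := by
      simpa using sq_sum_le_card_mul_sum_sq (s := Finset.univ) (f := fun i => min (W t i) 0)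
    have : d * (2 * C) * S ^ 2 ≤ d * (2 * C) * (d * N t) :=
      mul_le_mul_of_nonneg_left hcs (by positivity)
    linarith
  have hmono := monotoneOn_mul_exp hN hbound
  intro t ht
  have hab : a ≤ b := ht.1.trans ht.2
  have hNa : N a = 0 := Finset.sum_eq_zero fun i _ => by
    have : 0 ≤ W a i := h0 i
    rw [min_eq_right this, zero_pow two_ne_zero]
  have h1 := hmono ⟨le_rfl, hab⟩ ht ht.1
  simp only [hNa, neg_zero, zero_mul] at h1
  have h2 : N t ≤ 0 := by
    by_contra hcon
    have := mul_pos (not_le.1 hcon) (Real.exp_pos (-(2 * C * d * d) * t))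
    linarith
  intro i
  by_contra hcon
  have hi : W t i < 0 := by simpa using hcon
  have h3 : (min (W t i) 0) ^ 2 ≤ N t :=
    Finset.single_le_sum (f := fun i => (min (W t i) 0) ^ 2) (fun i _ => sq_nonneg _)
      (Finset.mem_univ i)
  rw [min_eq_left hi.le] at h3
  nlinarith

lemma le_diffusionField_of_adjacent (hh : 0 < h) (hd : 2 ≤ d) {L z : ℝ} (hL : 0 ≤ L)
    {w : Fin d → ℝ} (hw : 0 ≤ w) (hz : -L * coordFn w (d - 1) ≤ z) {i j : Fin d}
    (hij : (i : ℕ) = j + 1 ∨ (j : ℕ) = i + 1) :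
    -(2 / h ^ 2 * (1 + h * L)) * w i + 1 / h ^ 2 * w j ≤ diffusionField d h z w i := by
  have hn := coordFn_nonneg hw
  have hc : 0 ≤ 1 / h ^ 2 := by positivity
  rw [← coordFn_coe w i, ← coordFn_coe w j]
  have hLi : 0 ≤ h * L * coordFn w i := mul_nonneg (by positivity) (hn _)
  have key : -(2 / h ^ 2 * (1 + h * L)) * coordFn w i + 1 / h ^ 2 * coordFn w j
      = 1 / h ^ 2 * (-2 * coordFn w i - 2 * (h * L * coordFn w i) + coordFn w j) := by ring
  rw [key]
  unfold diffusionField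
  split_ifs with h0 h1
  · have hj : (j : ℕ) = 1 := by omega
    rw [show ∀ x : ℝ, 2 / h ^ 2 * x = 1 / h ^ 2 * (2 * x) from fun x => by ring]
    refine mul_le_mul_of_nonneg_left ?_ hc
    rw [h0] at hLi ⊢
    rw [hj]
    linarith [hn 1]
  · have hj : (j : ℕ) = d - 2 := by omega
    rw [show ∀ x : ℝ, 2 / h ^ 2 * x = 1 / h ^ 2 * (2 * x) from fun x => by ring]
    refine mul_le_mul_of_nonneg_left ?_ hc
    rw [h1] at hLi ⊢
    rw [hj]
    have := mul_le_mul_of_nonneg_left hz hh.le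
    linarith [hn (d - 2)]
  · refine mul_le_mul_of_nonneg_left ?_ hc
    rcases hij with hij | hij
    · rw [show (j : ℕ) = i - 1 by omega]
      linarith [hn (i + 1)]
    · rw [hij]
      linarith [hn (i - 1)]

/-- Strong positivity: a nonnegative supersolution of the linear diffusion problem with nonzero
initial state is positive in every coordinate at all later times. -/
lemma pos_of_diffusionField_le (hh : 0 < h) (hd : 2 ≤ d) {L a b : ℝ} (hL : 0 ≤ L)
    {W W' : ℝ → Fin d → ℝ} {z : ℝ → ℝ}
    (hW : ∀ t ∈ Icc a b, HasDerivWithinAt W (W' t) (Icc a b) t)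
    (hW' : ∀ t ∈ Icc a b, diffusionField d h (z t) (W t) ≤ W' t)
    (hz : ∀ t ∈ Icc a b, -L * coordFn (W t) (d - 1) ≤ z t)
    (h0 : ∀ t ∈ Icc a b, 0 ≤ W t) (hne : W a ≠ 0) :
    ∀ t ∈ Ioc a b, ∀ i, 0 < W t i := by
  set K : ℝ := 2 / h ^ 2 * (1 + h * L)
  have hWi : ∀ i, ∀ t ∈ Icc a b, HasDerivWithinAt (fun t => W t i) (W' t i) (Icc a b) t :=
    fun i t ht => hasDerivWithinAt_pi.1 (hW t ht) i
  have hadj : ∀ i j : Fin d, ((i : ℕ) = j + 1 ∨ (j : ℕ) = i + 1) → ∀ t ∈ Icc a b,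
      -K * W t i + 1 / h ^ 2 * W t j ≤ W' t i := fun i j hij t ht =>
    (le_diffusionField_of_adjacent hh hd hL (h0 t ht) (hz t ht) hij).trans (hW' t ht i)
  have hκ : 0 < 1 / h ^ 2 := by positivity
  have hex : ∀ i : Fin d, ∃ j : Fin d, (i : ℕ) = j + 1 ∨ (j : ℕ) = i + 1 := by
    intro i
    rcases Nat.eq_zero_or_pos i with hi | hi
    · exact ⟨⟨1, by omega⟩, Or.inr (by simp [hi])⟩
    · exact ⟨⟨i - 1, by omega⟩, Or.inl (by simp; omega)⟩
  have hstart : ∀ i, 0 < W a i → ∀ t ∈ Ioc a b, 0 < W t i := by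
    intro i hi t ht
    obtain ⟨j, hij⟩ := hex i
    have hmono := monotoneOn_mul_exp (K := K) (hWi i) fun s hs => by
      have := hadj i j hij s hs
      have := mul_nonneg hκ.le (h0 s hs j)
      linarith
    have h1 := hmono ⟨le_rfl, ht.1.le.trans ht.2⟩ ⟨ht.1.le, ht.2⟩ ht.1.le
    have h2 : 0 < W t i * Real.exp (K * t) :=
      (mul_pos hi (Real.exp_pos _)).trans_le h1
    exact pos_of_mul_pos_left h2 (Real.exp_pos _).le
  have hstep : ∀ i j : Fin d, ((i : ℕ) = j + 1 ∨ (j : ℕ) = i + 1) →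
      (∀ t ∈ Ioc a b, 0 < W t j) → ∀ t ∈ Ioc a b, 0 < W t i := by
    intro i j hij hj t ht
    have hmono := strictMonoOn_mul_exp (K := K) (hWi i) fun s hs => by
      have := hadj i j hij s ⟨hs.1.le, hs.2.le⟩
      have := mul_pos hκ (hj s ⟨hs.1, hs.2.le⟩)
      linarith
    have hab : a ∈ Icc a b := ⟨le_rfl, ht.1.le.trans ht.2⟩
    have h1 := hmono hab ⟨ht.1.le, ht.2⟩ ht.1
    have h2 : 0 < W t i * Real.exp (K * t) :=
      (mul_nonneg (h0 a hab i) (Real.exp_pos _).le).trans_lt h1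
    exact pos_of_mul_pos_left h2 (Real.exp_pos _).le
  intro t₁ ht₁
  have hab : a ∈ Icc a b := ⟨le_rfl, ht₁.1.le.trans ht₁.2⟩
  obtain ⟨i₀, hi₀⟩ := Function.ne_iff.1 hne
  have hP₀ := hstart i₀ (lt_of_le_of_ne (h0 a hab i₀) (Ne.symm hi₀))
  suffices hall : ∀ i, ∀ t ∈ Ioc a b, 0 < W t i from fun i => hall i t₁ ht₁
  have hup : ∀ n, (i₀ : ℕ) ≤ n → ∀ hn : n < d, ∀ t ∈ Ioc a b, 0 < W t ⟨n, hn⟩ := by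
    intro n hn
    induction n, hn using Nat.le_induction with
    | base => exact fun _ => hP₀
    | succ n _ ih =>
      exact fun hn => hstep _ ⟨n, by omega⟩ (Or.inl rfl) (ih (by omega))
  have hdown : ∀ n, n ≤ (i₀ : ℕ) → ∀ hn : n < d, ∀ t ∈ Ioc a b, 0 < W t ⟨n, hn⟩ := by
    intro n hn
    induction hn using Nat.decreasingInduction with
    | self => exact fun _ => hP₀
    | of_succ n hlt ih =>
      have := i₀.2
      exact fun hn => hstep _ ⟨n + 1, by omega⟩ (Or.inr rfl) (ih (by omega))
  intro i
  rcases le_total (i₀ : ℕ) i with hi | hi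
  · exact hup i hi i.2
  · exact hdown i hi i.2

lemma boundaryFlux_of_nonneg (p : ℝ) {x : ℝ} (hx : 0 ≤ x) : boundaryFlux p x = x ^ p - x := by
  rw [boundaryFlux, max_eq_left hx]

lemma rpow_eq_rpow_sub_one_mul {p : ℝ} (hp : 1 < p) {x : ℝ} (hx : 0 ≤ x) :
    x ^ p = x ^ (p - 1) * x := by
  have := Real.rpow_add_one' hx (y := p - 1) (by linarith)
  rwa [sub_add_cancel] at this

lemma boundaryFlux_mul_le {p : ℝ} (hp : 1 < p) {l x : ℝ} (hl0 : 0 ≤ l) (hl1 : l ≤ 1)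
    (hx : 0 ≤ x) : boundaryFlux p (l * x) ≤ l * boundaryFlux p x := by
  rw [boundaryFlux_of_nonneg p hx, boundaryFlux_of_nonneg p (mul_nonneg hl0 hx),
    Real.mul_rpow hl0 hx]
  have h1 : l ^ p ≤ l := by
    rw [rpow_eq_rpow_sub_one_mul hp hl0]
    exact mul_le_of_le_one_left hl0 (Real.rpow_le_one hl0 hl1 (by linarith))
  have := mul_le_mul_of_nonneg_right h1 (Real.rpow_nonneg hx p)
  linarith

lemma mul_boundaryFlux_le {p : ℝ} (hp : 1 < p) {l x : ℝ} (hl : 1 ≤ l) (hx : 0 ≤ x) :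
    l * boundaryFlux p x ≤ boundaryFlux p (l * x) := by
  have hl0 : 0 ≤ l := by linarith
  rw [boundaryFlux_of_nonneg p hx, boundaryFlux_of_nonneg p (mul_nonneg hl0 hx),
    Real.mul_rpow hl0 hx]
  have h1 : l ≤ l ^ p := by
    rw [rpow_eq_rpow_sub_one_mul hp hl0]
    exact le_mul_of_one_le_left hl0 (Real.one_le_rpow hl (by linarith))
  have := mul_le_mul_of_nonneg_right h1 (Real.rpow_nonneg hx p)
  linarith

lemma boundaryFlux_le_of_le {p : ℝ} (hp : 1 < p) {m x : ℝ} (hx : 0 ≤ x) (hxm : x ≤ m) :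
    boundaryFlux p x ≤ -(1 - m ^ (p - 1)) * x := by
  rw [boundaryFlux_of_nonneg p hx, rpow_eq_rpow_sub_one_mul hp hx]
  have := mul_le_mul_of_nonneg_right (Real.rpow_le_rpow hx hxm (by linarith : 0 ≤ p - 1)) hx
  linarith

lemma le_boundaryFlux_of_le {p : ℝ} (hp : 1 < p) {m x : ℝ} (hm : 0 ≤ m) (hmx : m ≤ x) :
    (m ^ (p - 1) - 1) * x ≤ boundaryFlux p x := by
  have hx : 0 ≤ x := hm.trans hmx
  rw [boundaryFlux_of_nonneg p hx, rpow_eq_rpow_sub_one_mul hp hx]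
  have := mul_le_mul_of_nonneg_right (Real.rpow_le_rpow hm hmx (by linarith : 0 ≤ p - 1)) hx
  linarith

lemma exists_rpow_sub_rpow_le {p : ℝ} (hp : 1 ≤ p) (R : ℝ) :
    ∃ L : ℝ, 0 ≤ L ∧ ∀ x y, 0 ≤ x → x ≤ y → y ≤ R → y ^ p - x ^ p ≤ L * (y - x) := by
  have h1 : ContDiff ℝ 1 fun x : ℝ => x ^ p := by
    simpa using Real.contDiff_rpow_const_of_le (p := p) (n := 1) (by simpa using hp)
  obtain ⟨K, hK⟩ := h1.locallyLipschitz.exists_lipschitzOnWith_closedBall R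
  refine ⟨K, K.2, fun x y hx hxy hy => ?_⟩
  have hmem : ∀ w, 0 ≤ w → w ≤ R → w ∈ Metric.closedBall (0 : ℝ) R := fun w h0 hw => by
    rwa [mem_closedBall_zero_iff, Real.norm_eq_abs, abs_of_nonneg h0]
  have := hK.dist_le_mul y (hmem y (hx.trans hxy) hy) x (hmem x hx (hxy.trans hy))
  rw [Real.dist_eq, Real.dist_eq, abs_of_nonneg (sub_nonneg.2 hxy)] at this
  exact (le_abs_self _).trans this

/-- Comparison of nonnegative sub- and supersolutions of system (1.1). -/
lemma le_of_subsolution_of_supersolution {p : ℝ} (hh : 0 < h) (hp : 1 < p) {a b : ℝ}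
    {X Y : ℝ → Fin d → ℝ} {y z : ℝ → ℝ}
    (hX : ∀ t ∈ Icc a b, HasDerivWithinAt X (diffusionField d h (y t) (X t)) (Icc a b) t)
    (hY : ∀ t ∈ Icc a b, HasDerivWithinAt Y (diffusionField d h (z t) (Y t)) (Icc a b) t)
    (hy : ∀ t ∈ Icc a b, y t ≤ boundaryFlux p (coordFn (X t) (d - 1)))
    (hz : ∀ t ∈ Icc a b, boundaryFlux p (coordFn (Y t) (d - 1)) ≤ z t)
    (hX0 : ∀ t ∈ Icc a b, 0 ≤ X t) (hY0 : ∀ t ∈ Icc a b, 0 ≤ Y t) (h0 : X a ≤ Y a) :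
    ∀ t ∈ Icc a b, X t ≤ Y t := by
  obtain ⟨R, hR⟩ := isCompact_Icc.exists_bound_of_continuousOn
    (fun t ht => (hX t ht).continuousWithinAt)
  obtain ⟨L, hL, hLR⟩ := exists_rpow_sub_rpow_le hp.le R
  have key := nonneg_of_diffusionField_le (a := a) (b := b) hh hL (W := Y - X)
    (z := fun t => z t - y t)
    (fun t ht => (hY t ht).sub (hX t ht)) (fun t _ => (diffusionField_sub _ _ _ _).le)
    (fun t ht hlt => ?_) (sub_nonneg.2 h0)
  · exact fun t ht => sub_nonneg.1 (key t ht)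
  · have hXn := coordFn_nonneg (hX0 t ht) (d - 1)
    have hYn := coordFn_nonneg (hY0 t ht) (d - 1)
    have hXR := (le_abs_self _).trans ((abs_coordFn_le (X t) (d - 1)).trans (hR t ht))
    have hy' := hy t ht
    have hz' := hz t ht
    rw [boundaryFlux_of_nonneg p hXn] at hy'
    rw [boundaryFlux_of_nonneg p hYn] at hz'
    rw [Pi.sub_apply, coordFn_sub] at hlt ⊢
    have := hLR _ _ hYn (by linarith) hXR
    linarith

lemma solution_nonneg {p : ℝ} (hh : 0 < h) {a b : ℝ} {U : ℝ → Fin d → ℝ}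
    (hU : IsIntegralCurveOn U (fun _ => bField d h p) (Icc a b)) (h0 : 0 ≤ U a) :
    ∀ t ∈ Icc a b, 0 ≤ U t := by
  refine nonneg_of_diffusionField_le hh le_rfl hU
    (fun t _ => (bField_eq_diffusionField p (U t)).ge) (fun t _ hlt => ?_) h0
  rw [boundaryFlux, zero_mul]
  have := Real.rpow_nonneg (le_max_right (coordFn (U t) (d - 1)) 0) p
  linarith

lemma solution_lt_of_ne {p : ℝ} (hh : 0 < h) (hd : 2 ≤ d) (hp : 1 < p) {a b : ℝ}
    {U V : ℝ → Fin d → ℝ}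
    (hU : IsIntegralCurveOn U (fun _ => bField d h p) (Icc a b))
    (hV : IsIntegralCurveOn V (fun _ => bField d h p) (Icc a b))
    (hU0 : ∀ t ∈ Icc a b, 0 ≤ U t) (hUV : ∀ t ∈ Icc a b, U t ≤ V t) (hne : U a ≠ V a) :
    ∀ t ∈ Ioc a b, ∀ i, U t i < V t i := by
  have key := pos_of_diffusionField_le (a := a) (b := b) hh hd zero_le_one (W := V - U)
    (z := fun t => boundaryFlux p (coordFn (V t) (d - 1)) - boundaryFlux p (coordFn (U t) (d - 1)))
    (fun t ht => (hV t ht).sub (hU t ht)) (fun t _ => (diffusionField_sub _ _ _ _).le)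
    (fun t ht => ?_) (fun t ht => sub_nonneg.2 (hUV t ht)) (sub_ne_zero.2 hne.symm)
  · exact fun t ht i => sub_pos.1 (key t ht i)
  · have hUn := coordFn_nonneg (hU0 t ht) (d - 1)
    have hle := coordFn_mono (hUV t ht) (d - 1)
    rw [boundaryFlux_of_nonneg p hUn, boundaryFlux_of_nonneg p (hUn.trans hle), Pi.sub_apply,
      coordFn_sub]
    have := Real.rpow_le_rpow hUn hle (by linarith : 0 ≤ p)
    linarith

/-- For the linear boundary flux `s * δ * x` with `s = ±1`, there is a positive profile which
decays (`s = -1`) or grows (`s = 1`) at least at a positive rate `ε`. -/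
lemma exists_exponential_profile (hh : 0 < h) (hd : 2 ≤ d) {s δ : ℝ} (hs : s = 1 ∨ s = -1)
    (hδ : 0 < δ) : ∃ ε > 0, ∃ φ : Fin d → ℝ, (∀ i, 1 / 2 ≤ φ i ∧ φ i ≤ 3 / 2) ∧
      ∀ i, ε * φ i ≤ s * diffusionField d h (s * δ * coordFn φ (d - 1)) φ i := by
  have hd2 : (2 : ℝ) ≤ d := by exact_mod_cast hd
  have hd0 : (0 : ℝ) < d := by linarith
  set η : ℝ := min (h * δ / (4 * d)) (1 / (2 * (d : ℝ) ^ 2))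
  have hη : 0 < η := lt_min (by positivity) (by positivity)
  have hη1 : η * (4 * d) ≤ h * δ := by
    rw [← le_div_iff₀ (by positivity)]; exact min_le_left _ _
  have hη2 : η * (d : ℝ) ^ 2 ≤ 1 / 2 := by
    have : η * (2 * (d : ℝ) ^ 2) ≤ 1 := by
      rw [← le_div_iff₀ (by positivity)]; exact min_le_right _ _
    linarith
  have hs2 : s * s = 1 := by rcases hs with rfl | rfl <;> norm_num
  set φ : Fin d → ℝ := fun i => 1 + s * η * (i : ℝ) ^ 2
  have hφ : ∀ n < d, coordFn φ n = 1 + s * η * (n : ℝ) ^ 2 := fun n hn => by simp [coordFn, hn, φ]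
  have hb : ∀ i, 1 / 2 ≤ φ i ∧ φ i ≤ 3 / 2 := by
    intro i
    have hi : (i : ℝ) ≤ d := by exact_mod_cast i.2.le
    have h1 : η * (i : ℝ) ^ 2 ≤ 1 / 2 :=
      (mul_le_mul_of_nonneg_left (by gcongr) hη.le).trans hη2
    have h2 : 0 ≤ η * (i : ℝ) ^ 2 := by positivity
    simp only [φ]
    rcases hs with rfl | rfl <;> constructor <;> linarith
  have hc : 0 < 1 / h ^ 2 := by positivity
  refine ⟨η / h ^ 2, by positivity, φ, hb, fun i => ?_⟩
  have hlhs : η / h ^ 2 * φ i ≤ 1 / h ^ 2 * (2 * η) := by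
    have := mul_le_mul_of_nonneg_left (hb i).2 (by positivity : 0 ≤ η / h ^ 2)
    have h2 : η / h ^ 2 * (3 / 2) = 1 / h ^ 2 * (3 / 2 * η) := by ring
    have h3 := mul_le_mul_of_nonneg_left (by linarith : 3 / 2 * η ≤ 2 * η) hc.le
    linarith
  refine hlhs.trans ?_
  unfold diffusionField
  split_ifs with h0 h1
  · rw [hφ 0 (by omega), hφ 1 (by omega)]
    have : s * (2 / h ^ 2 * (-(1 + s * η * ((0 : ℕ) : ℝ) ^ 2) + (1 + s * η * ((1 : ℕ) : ℝ) ^ 2)))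
        = (s * s) * (1 / h ^ 2 * (2 * η)) := by push_cast; ring
    rw [this, hs2, one_mul]
  · have hlast := (hb ⟨d - 1, by omega⟩).1
    have e1 : φ ⟨d - 1, by omega⟩ = coordFn φ (d - 1) := by simp [coordFn, show 0 < d by omega]
    rw [e1] at hlast
    set x := coordFn φ (d - 1) with hx
    have hx' : x = 1 + s * η * ((d : ℝ) - 1) ^ 2 := by
      rw [hx, hφ _ (by omega)]; push_cast [show 1 ≤ d by omega]; ring
    have hy' : coordFn φ (d - 2) = 1 + s * η * ((d : ℝ) - 2) ^ 2 := by
      rw [hφ _ (by omega)]; push_cast [hd]; ring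
    have e2 : s * (2 / h ^ 2 * (-x + coordFn φ (d - 2) + h * (s * δ * x)))
        = 1 / h ^ 2 * (2 * (s * (-x + coordFn φ (d - 2))) + 2 * ((s * s) * (h * δ * x))) := by
      ring
    have e3 : s * (-x + coordFn φ (d - 2)) = (s * s) * (-(η * (2 * d - 3))) := by
      rw [hx', hy']; ring
    rw [e2, e3, hs2]
    refine mul_le_mul_of_nonneg_left ?_ hc.le
    have h4 : h * δ * (1 / 2) ≤ h * δ * x := mul_le_mul_of_nonneg_left hlast (by positivity)
    linarith
  · have hi : 1 ≤ (i : ℕ) := by omega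
    have hi' := i.2
    rw [hφ _ (by omega), hφ _ (by omega), hφ _ (by omega)]
    push_cast [hi]
    have : s * (1 / h ^ 2 * (1 + s * η * ((i : ℝ) + 1) ^ 2 - 2 * (1 + s * η * (i : ℝ) ^ 2)
        + (1 + s * η * ((i : ℝ) - 1) ^ 2))) = (s * s) * (1 / h ^ 2 * (2 * η)) := by ring
    rw [this, hs2, one_mul]

lemma hasDerivAt_exp_smul (c k a : ℝ) (φ : Fin d → ℝ) (t : ℝ) :
    HasDerivAt (fun t => (c * Real.exp (k * (t - a))) • φ)
      ((c * Real.exp (k * (t - a))) • k • φ) t := by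
  have h1 : HasDerivAt (fun t : ℝ => k * (t - a)) k t := by
    simpa using ((hasDerivAt_id t).sub_const a).const_mul k
  refine ((h1.exp.const_mul c).smul_const φ).congr_deriv ?_
  rw [smul_smul, mul_assoc]

lemma exists_exponential_decay {p : ℝ} (hh : 0 < h) (hd : 2 ≤ d) {δ : ℝ} (hδ : 0 < δ) :
    ∃ ε > 0, ∀ (a b : ℝ) (V : ℝ → Fin d → ℝ),
      IsIntegralCurveOn V (fun _ => bField d h p) (Icc a b) →
      (∀ t ∈ Icc a b, boundaryFlux p (coordFn (V t) (d - 1)) ≤ -δ * coordFn (V t) (d - 1)) →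
      (∀ i, V a i ≤ 1) → ∀ t ∈ Icc a b, ∀ i, V t i ≤ 3 * Real.exp (-ε * (t - a)) := by
  obtain ⟨ε, hε, φ, hφ, hφ'⟩ := exists_exponential_profile hh hd (s := -1) (Or.inr rfl) hδ
  refine ⟨ε, hε, fun a b V hV hflux ha t ht i => ?_⟩
  set X : ℝ → Fin d → ℝ := fun t => (2 * Real.exp (-ε * (t - a))) • φ with hX
  have hk : ∀ t, 0 ≤ 2 * Real.exp (-ε * (t - a)) := fun t => by positivity
  have key := nonneg_of_diffusionField_le (a := a) (b := b) hh le_rfl (W := X - V)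
    (z := fun t => -δ * coordFn (X t) (d - 1) - boundaryFlux p (coordFn (V t) (d - 1)))
    (fun t ht => ((hasDerivAt_exp_smul 2 (-ε) a φ t).hasDerivWithinAt).sub (hV t ht))
    (fun t _ => ?_) (fun t ht hlt => ?_) ?_ t ht i
  · have h1 : V t i ≤ 2 * Real.exp (-ε * (t - a)) * φ i := sub_nonneg.1 key
    have h2 := mul_le_mul_of_nonneg_left (hφ i).2 (hk t)
    linarith
  · rw [Pi.sub_apply, diffusionField_sub]
    refine sub_le_sub_right ?_ _
    have e : -δ * coordFn (X t) (d - 1)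
        = 2 * Real.exp (-ε * (t - a)) * (-1 * δ * coordFn φ (d - 1)) := by
      rw [hX, coordFn_smul]; ring
    rw [e, hX, diffusionField_smul]
    intro j
    simp only [Pi.smul_apply, smul_eq_mul]
    refine mul_le_mul_of_nonneg_left ?_ (hk t)
    linarith [hφ' j]
  · rw [Pi.sub_apply, coordFn_sub] at hlt ⊢
    have h1 := hflux t ht
    have h2 := mul_lt_mul_of_pos_left hlt hδ
    linarith
  · intro j
    have h1 : X a j = 2 * φ j := by simp [hX]
    have h2 : V a j ≤ X a j := by rw [h1]; linarith [(hφ j).1, ha j]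
    exact sub_nonneg.2 h2

lemma exists_exponential_growth {p : ℝ} (hh : 0 < h) (hd : 2 ≤ d) {δ : ℝ} (hδ : 0 < δ) :
    ∃ ε > 0, ∀ (a b : ℝ) (V : ℝ → Fin d → ℝ),
      IsIntegralCurveOn V (fun _ => bField d h p) (Icc a b) →
      (∀ t ∈ Icc a b, δ * coordFn (V t) (d - 1) ≤ boundaryFlux p (coordFn (V t) (d - 1))) →
      (∀ i, 1 ≤ V a i) → ∀ t ∈ Icc a b, ∀ i, 1 / 3 * Real.exp (ε * (t - a)) ≤ V t i := by
  obtain ⟨ε, hε, φ, hφ, hφ'⟩ := exists_exponential_profile hh hd (s := 1) (Or.inl rfl) hδ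
  refine ⟨ε, hε, fun a b V hV hflux ha t ht i => ?_⟩
  set X : ℝ → Fin d → ℝ := fun t => (2 / 3 * Real.exp (ε * (t - a))) • φ with hX
  have hk : ∀ t, 0 ≤ 2 / 3 * Real.exp (ε * (t - a)) := fun t => by positivity
  have key := nonneg_of_diffusionField_le (a := a) (b := b) hh hδ.le (W := V - X)
    (z := fun t => boundaryFlux p (coordFn (V t) (d - 1)) - δ * coordFn (X t) (d - 1))
    (fun t ht => (hV t ht).sub ((hasDerivAt_exp_smul (2 / 3) ε a φ t).hasDerivWithinAt))
    (fun t _ => ?_) (fun t ht hlt => ?_) ?_ t ht i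
  · have h1 : 2 / 3 * Real.exp (ε * (t - a)) * φ i ≤ V t i := sub_nonneg.1 key
    have h2 := mul_le_mul_of_nonneg_left (hφ i).1 (hk t)
    linarith
  · rw [Pi.sub_apply, diffusionField_sub]
    refine sub_le_sub_left ?_ _
    have e : δ * coordFn (X t) (d - 1)
        = 2 / 3 * Real.exp (ε * (t - a)) * (1 * δ * coordFn φ (d - 1)) := by
      rw [hX, coordFn_smul]; ring
    rw [e, hX, diffusionField_smul]
    intro j
    simp only [Pi.smul_apply, smul_eq_mul]
    refine mul_le_mul_of_nonneg_left ?_ (hk t)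
    linarith [hφ' j]
  · rw [Pi.sub_apply, coordFn_sub]
    linarith [hflux t ht]
  · intro j
    have h1 : X a j = 2 / 3 * φ j := by simp [hX]
    have h2 : X a j ≤ V a j := by rw [h1]; linarith [(hφ j).2, ha j]
    exact sub_nonneg.2 h2

/-- A positive function cannot satisfy `x' ≥ c x ^ p` with `p > 1` on a half-line. -/
lemma false_of_rpow_le_deriv {p c T : ℝ} (hp : 1 < p) (hc : 0 < c) {x x' : ℝ → ℝ}
    (hx : ∀ t ∈ Ici T, HasDerivWithinAt x (x' t) (Ici T) t) (hpos : ∀ t ∈ Ici T, 0 < x t)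
    (hle : ∀ t ∈ Ici T, c * x t ^ p ≤ x' t) : False := by
  have hderiv : ∀ t ∈ Ici T, HasDerivWithinAt (fun t => x t ^ (1 - p) + (p - 1) * c * t)
      (x' t * (1 - p) * x t ^ (1 - p - 1) + (p - 1) * c) (Ici T) t := by
    intro t ht
    refine ((hx t ht).rpow_const (Or.inl (hpos t ht).ne')).add ?_
    simpa using ((hasDerivAt_id t).const_mul ((p - 1) * c)).hasDerivWithinAt
  have hanti : AntitoneOn (fun t => x t ^ (1 - p) + (p - 1) * c * t) (Ici T) := by
    refine antitoneOn_of_hasDerivWithinAt_nonpos (convex_Ici T)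
      (fun t ht => (hderiv t ht).continuousWithinAt)
      (fun t ht => (hderiv t (interior_subset ht)).mono interior_subset) fun t ht => ?_
    have ht' := interior_subset ht
    have h1 : x t ^ p * x t ^ (1 - p - 1) = 1 := by
      rw [← Real.rpow_add (hpos t ht')]; simp
    have h2 := mul_le_mul_of_nonneg_right (hle t ht')
      (Real.rpow_nonneg (hpos t ht').le (1 - p - 1))
    have h3 : c ≤ x' t * x t ^ (1 - p - 1) := by
      rwa [mul_assoc, h1, mul_one] at h2
    have h4 := mul_le_mul_of_nonneg_left h3 (by linarith : 0 ≤ p - 1)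
    linarith
  have hk : 0 < (p - 1) * c := mul_pos (by linarith) hc
  set A := x T ^ (1 - p)
  have hA : 0 < A := Real.rpow_pos_of_pos (hpos T self_mem_Ici) _
  have hmem : T + A / ((p - 1) * c) ∈ Ici T := by
    rw [mem_Ici]; linarith [div_pos hA hk]
  have h1 := hanti self_mem_Ici hmem hmem
  have h2 := Real.rpow_pos_of_pos (hpos _ hmem) (1 - p)
  have h3 : (p - 1) * c * (T + A / ((p - 1) * c)) = (p - 1) * c * T + A := by
    rw [mul_add, mul_div_cancel₀ _ hk.ne']
  simp only [h3] at h1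
  linarith

lemma norm_le_euclNorm (u : Fin d → ℝ) : ‖u‖ ≤ euclNorm u := by
  refine (pi_norm_le_iff_of_nonneg (Real.sqrt_nonneg _)).2 fun i => ?_
  refine Real.abs_le_sqrt ?_
  exact Finset.single_le_sum (f := fun i => u i ^ 2) (fun i _ => sq_nonneg _) (Finset.mem_univ i)

lemma norm_le_norm_of_nonneg_of_le {u v : Fin d → ℝ} (hu : 0 ≤ u) (huv : u ≤ v) : ‖u‖ ≤ ‖v‖ := by
  refine (pi_norm_le_iff_of_nonneg (norm_nonneg _)).2 fun i => ?_
  rw [Real.norm_eq_abs, abs_of_nonneg (hu i)]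
  exact (huv i).trans ((le_abs_self _).trans (norm_le_pi_norm v i))

lemma exists_le_smul_of_lt {x y : Fin d → ℝ} (hxy : ∀ i, x i < y i) :
    ∃ l : ℝ, 0 ≤ l ∧ l < 1 ∧ x ≤ l • y := by
  have h1 : ∀ᶠ l : ℝ in 𝓝[<] 1, ∀ i, x i < l * y i := eventually_all.2 fun i => by
    have : Tendsto (fun l : ℝ => l * y i) (𝓝[<] 1) (𝓝 (1 * y i)) :=
      ((continuous_id.mul continuous_const).tendsto 1).mono_left nhdsWithin_le_nhds
    rw [one_mul] at this
    exact this.eventually (lt_mem_nhds (hxy i))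
  have h2 : ∀ᶠ l : ℝ in 𝓝[<] 1, 0 < l :=
    nhdsWithin_le_nhds (lt_mem_nhds zero_lt_one)
  obtain ⟨l, ⟨hl, hl0⟩, hl1⟩ := ((h1.and h2).and self_mem_nhdsWithin).exists
  exact ⟨l, hl0.le, hl1, fun i => (hl i).le⟩

lemma exists_smul_le_of_lt {x y : Fin d → ℝ} (hxy : ∀ i, x i < y i) :
    ∃ l : ℝ, 1 < l ∧ l • x ≤ y := by
  have h1 : ∀ᶠ l : ℝ in 𝓝[>] 1, ∀ i, l * x i < y i := eventually_all.2 fun i => by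
    have : Tendsto (fun l : ℝ => l * x i) (𝓝[>] 1) (𝓝 (1 * x i)) :=
      ((continuous_id.mul continuous_const).tendsto 1).mono_left nhdsWithin_le_nhds
    rw [one_mul] at this
    exact this.eventually (gt_mem_nhds (hxy i))
  obtain ⟨l, hl, hl1⟩ := (h1.and self_mem_nhdsWithin).exists
  exact ⟨l, hl1, fun i => (hl i).le⟩

lemma IsIntegralCurveOn.Icc_of_Ici {p a b : ℝ} {U : ℝ → Fin d → ℝ}
    (hU : IsIntegralCurveOn U (fun _ => bField d h p) (Ici 0)) (ha : 0 ≤ a) :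
    IsIntegralCurveOn U (fun _ => bField d h p) (Icc a b) :=
  hU.mono fun _ ht => ha.trans ht.1

lemma IsIntegralCurveOn.hasDerivWithinAt_smul {p a b : ℝ} {U : ℝ → Fin d → ℝ}
    (hU : IsIntegralCurveOn U (fun _ => bField d h p) (Icc a b)) (l : ℝ) :
    ∀ t ∈ Icc a b, HasDerivWithinAt (l • U)
      (diffusionField d h (l * boundaryFlux p (coordFn (U t) (d - 1))) ((l • U) t))
      (Icc a b) t := by
  intro t ht
  rw [Pi.smul_apply, diffusionField_smul]
  exact (hU t ht).const_smul l

lemma solution_mono {p : ℝ} (hh : 0 < h) (hp : 1 < p) {a b : ℝ} {U V : ℝ → Fin d → ℝ}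
    (hU : IsIntegralCurveOn U (fun _ => bField d h p) (Icc a b))
    (hV : IsIntegralCurveOn V (fun _ => bField d h p) (Icc a b))
    (hU0 : 0 ≤ U a) (hUV : U a ≤ V a) : ∀ t ∈ Icc a b, U t ≤ V t :=
  le_of_subsolution_of_supersolution hh hp hU hV (fun _ _ => le_rfl) (fun _ _ => le_rfl)
    (solution_nonneg hh hU hU0) (solution_nonneg hh hV (hU0.trans hUV)) hUV

/-- Two distinct ordered nonnegative global solutions are separated by a constant factor
after time `1`: the smaller one is at most `l < 1` times the larger one. -/
lemma exists_le_smul_solution {p : ℝ} (hh : 0 < h) (hd : 2 ≤ d) (hp : 1 < p)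
    {U V : ℝ → Fin d → ℝ}
    (hU : IsIntegralCurveOn U (fun _ => bField d h p) (Ici 0))
    (hV : IsIntegralCurveOn V (fun _ => bField d h p) (Ici 0))
    (hU0 : 0 ≤ U 0) (hUV : U 0 ≤ V 0) (hne : U 0 ≠ V 0) :
    ∃ l : ℝ, 0 ≤ l ∧ l < 1 ∧ ∀ t, 1 ≤ t → U t ≤ l • V t := by
  have hUn : ∀ t, 0 ≤ t → 0 ≤ U t := fun t ht =>
    solution_nonneg hh (hU.Icc_of_Ici le_rfl) hU0 t ⟨ht, le_rfl⟩
  have hle : ∀ t, 0 ≤ t → U t ≤ V t := fun t ht =>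
    solution_mono hh hp (hU.Icc_of_Ici le_rfl) (hV.Icc_of_Ici le_rfl) hU0 hUV t ⟨ht, le_rfl⟩
  have hVn : ∀ t, 0 ≤ t → 0 ≤ V t := fun t ht => (hUn t ht).trans (hle t ht)
  obtain ⟨l, hl0, hl1, hl⟩ := exists_le_smul_of_lt
    (solution_lt_of_ne hh hd hp (hU.Icc_of_Ici le_rfl) (hV.Icc_of_Ici le_rfl)
      (fun t ht => hUn t ht.1) (fun t ht => hle t ht.1) hne 1 ⟨zero_lt_one, le_rfl⟩)
  refine ⟨l, hl0, hl1, fun t ht => ?_⟩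
  refine le_of_subsolution_of_supersolution hh hp (hU.Icc_of_Ici zero_le_one)
    ((hV.Icc_of_Ici zero_le_one).hasDerivWithinAt_smul l) (fun _ _ => le_rfl) (fun s hs => ?_)
    (fun s hs => hUn s (zero_le_one.trans hs.1))
    (fun s hs => smul_nonneg hl0 (hVn s (zero_le_one.trans hs.1))) hl t ⟨ht, le_rfl⟩
  rw [Pi.smul_apply, coordFn_smul]
  exact boundaryFlux_mul_le hp hl0 hl1.le
    (coordFn_nonneg (hVn s (zero_le_one.trans hs.1)) (d - 1))

/-- Two distinct ordered nonnegative global solutions are separated by a constant factor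
after time `1`: the larger one is at least `l > 1` times the smaller one. -/
lemma exists_smul_solution_le {p : ℝ} (hh : 0 < h) (hd : 2 ≤ d) (hp : 1 < p)
    {U V : ℝ → Fin d → ℝ}
    (hU : IsIntegralCurveOn U (fun _ => bField d h p) (Ici 0))
    (hV : IsIntegralCurveOn V (fun _ => bField d h p) (Ici 0))
    (hU0 : 0 ≤ U 0) (hUV : U 0 ≤ V 0) (hne : U 0 ≠ V 0) :
    ∃ l : ℝ, 1 < l ∧ ∀ t, 1 ≤ t → l • U t ≤ V t := by
  have hUn : ∀ t, 0 ≤ t → 0 ≤ U t := fun t ht =>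
    solution_nonneg hh (hU.Icc_of_Ici le_rfl) hU0 t ⟨ht, le_rfl⟩
  have hle : ∀ t, 0 ≤ t → U t ≤ V t := fun t ht =>
    solution_mono hh hp (hU.Icc_of_Ici le_rfl) (hV.Icc_of_Ici le_rfl) hU0 hUV t ⟨ht, le_rfl⟩
  obtain ⟨l, hl1, hl⟩ := exists_smul_le_of_lt
    (solution_lt_of_ne hh hd hp (hU.Icc_of_Ici le_rfl) (hV.Icc_of_Ici le_rfl)
      (fun t ht => hUn t ht.1) (fun t ht => hle t ht.1) hne 1 ⟨zero_lt_one, le_rfl⟩)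
  have hl0 : 0 ≤ l := by linarith
  refine ⟨l, hl1, fun t ht => ?_⟩
  refine le_of_subsolution_of_supersolution hh hp
    ((hU.Icc_of_Ici zero_le_one).hasDerivWithinAt_smul l) (hV.Icc_of_Ici zero_le_one)
    (fun s hs => ?_) (fun _ _ => le_rfl)
    (fun s hs => smul_nonneg hl0 (hUn s (zero_le_one.trans hs.1)))
    (fun s hs => (hUn s (zero_le_one.trans hs.1)).trans (hle s (zero_le_one.trans hs.1)))
    hl t ⟨ht, le_rfl⟩
  rw [Pi.smul_apply, coordFn_smul]
  exact mul_boundaryFlux_le hp hl1.le (coordFn_nonneg (hUn s (zero_le_one.trans hs.1)) (d - 1))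

lemma tendsto_zero_of_eventually_le {p m : ℝ} (hh : 0 < h) (hd : 2 ≤ d) (hp : 1 < p)
    (hm0 : 0 ≤ m) (hm : m < 1) {V : ℝ → Fin d → ℝ}
    (hV : IsIntegralCurveOn V (fun _ => bField d h p) (Ici 0)) (hV0 : ∀ t, 0 ≤ t → 0 ≤ V t)
    (hle : ∀ᶠ t in atTop, ∀ i, V t i ≤ m) : Tendsto V atTop (𝓝 0) := by
  obtain ⟨T, hT⟩ := eventually_atTop.1 (hle.and (eventually_ge_atTop 0))
  have hT0 : 0 ≤ T := (hT T le_rfl).2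
  have hδ : 0 < 1 - m ^ (p - 1) := sub_pos.2 (Real.rpow_lt_one hm0 hm (by linarith))
  obtain ⟨ε, hε, hdecay⟩ := exists_exponential_decay (p := p) hh hd hδ
  have hcoord : ∀ t, T ≤ t → coordFn (V t) (d - 1) ≤ m := fun t ht => by
    rw [coordFn, dif_pos (by omega)]
    exact (hT t ht).1 _
  have hb : ∀ t, T ≤ t → ∀ i, V t i ≤ 3 * Real.exp (-ε * (t - T)) := fun t ht =>
    hdecay T t V (hV.Icc_of_Ici hT0)
      (fun s hs => boundaryFlux_le_of_le hp
        (coordFn_nonneg (hV0 s (hT0.trans hs.1)) _) (hcoord s hs.1))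
      (fun i => ((hT T le_rfl).1 i).trans hm.le) t ⟨ht, le_rfl⟩
  have hlim : Tendsto (fun t => 3 * Real.exp (-ε * (t - T))) atTop (𝓝 0) := by
    have h1 : Tendsto (fun t : ℝ => -ε * (t - T)) atTop atBot :=
      (tendsto_atTop_add_const_right atTop (-T) tendsto_id).const_mul_atTop_of_neg
        (neg_neg_of_pos hε)
    simpa using (Real.tendsto_exp_atBot.comp h1).const_mul 3
  refine tendsto_pi_nhds.2 fun i => ?_
  refine tendsto_of_tendsto_of_tendsto_of_le_of_le' tendsto_const_nhds hlim ?_ ?_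
  · filter_upwards [eventually_ge_atTop 0] with t ht using hV0 t ht i
  · filter_upwards [eventually_ge_atTop T] with t ht using hb t ht i

lemma rpow_div_le_bField_last {p : ℝ} (hh : 0 < h) (hd : 2 ≤ d) (hp : 1 < p) {u : Fin d → ℝ}
    (hu : 0 ≤ u) (i : Fin d) (hi : (i : ℕ) = d - 1) (hbig : 2 * (1 + h) ≤ h * u i ^ (p - 1)) :
    1 / h * u i ^ p ≤ bField d h p u i := by
  have hx : 0 ≤ u i := hu i
  have e : coordFn u (d - 1) = u i := by rw [← hi, coordFn_coe]
  rw [bField_eq_diffusionField, diffusionField, if_neg (by omega), if_pos hi, e,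
    boundaryFlux_of_nonneg p hx]
  have h1 := mul_le_mul_of_nonneg_right hbig hx
  rw [mul_assoc h, ← rpow_eq_rpow_sub_one_mul hp hx] at h1
  have h2 : 1 / h * u i ^ p = 2 / h ^ 2 * (h * u i ^ p / 2) := by field_simp
  rw [h2]
  refine mul_le_mul_of_nonneg_left ?_ (by positivity)
  linarith [coordFn_nonneg hu (d - 2)]

lemma false_of_eventually_ge {p m : ℝ} (hh : 0 < h) (hd : 2 ≤ d) (hp : 1 < p)
    (hm : 1 < m) {V : ℝ → Fin d → ℝ}
    (hV : IsIntegralCurveOn V (fun _ => bField d h p) (Ici 0))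
    (hge : ∀ᶠ t in atTop, ∀ i, m ≤ V t i) : False := by
  obtain ⟨T, hT⟩ := eventually_atTop.1 (hge.and (eventually_ge_atTop 0))
  have hT0 : 0 ≤ T := (hT T le_rfl).2
  have hδ : 0 < m ^ (p - 1) - 1 := sub_pos.2 (Real.one_lt_rpow hm (by linarith))
  obtain ⟨ε, hε, hgrow⟩ := exists_exponential_growth (p := p) hh hd hδ
  set k : Fin d := ⟨d - 1, by omega⟩
  have hcoord : ∀ t, T ≤ t → m ≤ coordFn (V t) (d - 1) := fun t ht => by
    rw [coordFn, dif_pos (by omega)]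
    exact (hT t ht).1 _
  have hb : ∀ t, T ≤ t → 1 / 3 * Real.exp (ε * (t - T)) ≤ V t k := fun t ht =>
    hgrow T t V (hV.Icc_of_Ici hT0)
      (fun s hs => le_boundaryFlux_of_le hp (by linarith) (hcoord s hs.1))
      (fun i => hm.le.trans ((hT T le_rfl).1 i)) t ⟨ht, le_rfl⟩ k
  have hlim : Tendsto (fun t => 1 / 3 * Real.exp (ε * (t - T))) atTop atTop := by
    have h1 : Tendsto (fun t : ℝ => ε * (t - T)) atTop atTop :=
      (tendsto_atTop_add_const_right atTop (-T) tendsto_id).const_mul_atTop hε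
    exact (Real.tendsto_exp_atTop.comp h1).const_mul_atTop (by norm_num)
  have hVk : Tendsto (fun t => V t k) atTop atTop :=
    tendsto_atTop_mono' _ ((eventually_ge_atTop T).mono hb) hlim
  have hbig : ∀ᶠ t in atTop, 2 * (1 + h) ≤ h * V t k ^ (p - 1) :=
    (((tendsto_rpow_atTop (by linarith : 0 < p - 1)).comp hVk).const_mul_atTop
      hh).eventually_ge_atTop _
  obtain ⟨S, hS⟩ := eventually_atTop.1 (hbig.and (eventually_ge_atTop T))
  have hS0 : 0 ≤ S := hT0.trans (hS S le_rfl).2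
  have hVpos : ∀ t ∈ Ici S, ∀ i, 0 < V t i := fun t ht i => by
    linarith [(hT t (hS t ht).2).1 i]
  exact false_of_rpow_le_deriv (T := S) (x := fun t => V t k) hp (one_div_pos.2 hh)
    (fun t ht => hasDerivWithinAt_pi.1
      ((hV t (hS0.trans ht)).mono (Ici_subset_Ici.2 hS0)) k)
    (fun t ht => hVpos t ht k)
    (fun t ht => rpow_div_le_bField_last hh hd hp (fun i => (hVpos t ht i).le) k rfl
      (hS t ht).1)

/-- A nonnegative solution dominated by a global solution does not explode. -/
lemma not_tendsto_norm_of_le {p τ : ℝ} (hh : 0 < h) (hp : 1 < p) (hτ : 0 < τ)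
    {U V : ℝ → Fin d → ℝ}
    (hU : IsIntegralCurveOn U (fun _ => bField d h p) (Ici 0))
    (hV : IsIntegralCurveOn V (fun _ => bField d h p) (Ico 0 τ))
    (hV0 : 0 ≤ V 0) (hVU : V 0 ≤ U 0) :
    ¬ Tendsto (fun t => ‖V t‖) (𝓝[<] τ) atTop := by
  intro hlim
  obtain ⟨R, hR⟩ := isCompact_Icc.exists_bound_of_continuousOn (s := Icc 0 τ)
    (fun t ht => (hU.Icc_of_Ici le_rfl t ht).continuousWithinAt)
  obtain ⟨t, ht, htτ⟩ := ((hlim.eventually_gt_atTop R).and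
    (Ioo_mem_nhdsLT hτ)).exists
  have hVt : IsIntegralCurveOn V (fun _ => bField d h p) (Icc 0 t) :=
    hV.mono fun s hs => ⟨hs.1, hs.2.trans_lt htτ.2⟩
  have h1 := norm_le_norm_of_nonneg_of_le
    (solution_nonneg hh hVt hV0 t ⟨htτ.1.le, le_rfl⟩)
    (solution_mono hh hp hVt (hU.Icc_of_Ici le_rfl) hV0 hVU t ⟨htτ.1.le, le_rfl⟩)
  exact absurd (h1.trans (hR t ⟨htτ.1.le, htτ.2.le⟩)) (not_le.2 ht)

end DiffusionField

/-- if `u ≥ 0` and the maximal solution from `u` is global with limit `𝟙`, then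
(a) from any `v` with `0 ≤ v ≤ u`, `v ≠ u`, the solution is global with limit `0`, and
(b) from any `v ≥ u`, `v ≠ u`, the solution blows up in finite time. -/
theorem stmt10 (d : ℕ) (hd : 2 ≤ d) (h p : ℝ) (hh : 0 < h) (hp : 1 < p)
    (u : Fin d → ℝ) (hu : ∀ i, 0 ≤ u i)
    (hglob : GlobalTo d h p u (fun _ => 1)) :
    (∀ v : Fin d → ℝ, (∀ i, 0 ≤ v i) → (∀ i, v i ≤ u i) → v ≠ u → GlobalTo d h p v 0) ∧
    (∀ v : Fin d → ℝ, (∀ i, u i ≤ v i) → v ≠ u → BlowsUp d h p v) := by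
  obtain ⟨U, hU0, hU, hUlim⟩ := hglob
  subst hU0
  replace hU : IsIntegralCurveOn U (fun _ => bField d h p) (Ici 0) := hU
  have hUi : ∀ i, Tendsto (fun t => U t i) atTop (𝓝 1) := tendsto_pi_nhds.1 hUlim
  refine ⟨fun v hv0 hvu hne => ?_, fun v huv hne => ?_⟩
  · rcases (locallyLipschitz_bField (d := d) (h := h) hp.le).exists_global_or_blowup v with
      ⟨V, rfl, hV⟩ | ⟨τ, V, hτ, rfl, hV, hlim⟩
    · obtain ⟨l, hl0, hl1, hl⟩ := exists_le_smul_solution hh hd hp hV hU hv0 hvu hne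
      refine ⟨V, rfl, hV, tendsto_zero_of_eventually_le (m := (1 + l) / 2) hh hd hp
        (by linarith) (by linarith) hV
        (fun t ht => solution_nonneg hh (hV.Icc_of_Ici le_rfl) hv0 t ⟨ht, le_rfl⟩) ?_⟩
      refine eventually_all.2 fun i => ?_
      have h1 : Tendsto (fun t => l * U t i) atTop (𝓝 (l * 1)) := (hUi i).const_mul l
      filter_upwards [h1.eventually (gt_mem_nhds (show l * 1 < (1 + l) / 2 by linarith)),
        eventually_ge_atTop 1] with t ht ht1
      exact (hl t ht1 i).trans ht.le
    · exact absurd hlim (not_tendsto_norm_of_le hh hp hτ hU hV hv0 hvu)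
  · rcases (locallyLipschitz_bField (d := d) (h := h) hp.le).exists_global_or_blowup v with
      ⟨V, rfl, hV⟩ | ⟨τ, V, hτ, rfl, hV, hlim⟩
    · obtain ⟨l, hl1, hl⟩ := exists_smul_solution_le hh hd hp hU hV hu huv hne.symm
      refine (false_of_eventually_ge (m := (1 + l) / 2) hh hd hp (by linarith) hV ?_).elim
      refine eventually_all.2 fun i => ?_
      have h1 : Tendsto (fun t => l * U t i) atTop (𝓝 (l * 1)) := (hUi i).const_mul l
      filter_upwards [h1.eventually (lt_mem_nhds (show (1 + l) / 2 < l * 1 by linarith)),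
        eventually_ge_atTop 1] with t ht ht1
      exact ht.le.trans (hl t ht1 i)
    · exact ⟨τ, V, hτ, rfl, hV, tendsto_atTop_mono (fun t => norm_le_euclNorm (V t)) hlim⟩
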